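/- arXiv:1306.2012 — 2 statements merged into one kernel-verified Lean document; each statement's English description precedes it below -/
import Mathlib

section
/- Let r ≥ 3 be fixed. There exist constants C > 0, δ > 0 and M_0 depending only on r such that for every degree sequence k with sum M ≥ M_0 divisible by r, k_max ≥ 2 and k_max^3 ≤ δM, the probability that a uniformly random Q ∈ Λ_r(k) has more than N parts containing a loop is at most C/M, where N = max(⌈log M⌉, ⌈9(r−1)M_2/M⌉). -/
open scoped Classical BigOperators

/-- The set of points for the configuration model: cell `i` contains `k i` points. -/
abbrev Pts {n : ℕ} (k : Fin n → ℕ) : Type := (i : Fin n) × Fin (k i)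

/-- `M`, the total degree. -/
def Mtot {n : ℕ} (k : Fin n → ℕ) : ℕ := ∑ i, k i

/-- `M₂ = Σ kᵢ(kᵢ−1)`. -/
def M2 {n : ℕ} (k : Fin n → ℕ) : ℕ := ∑ i, k i * (k i - 1)

/-- `M₃ = Σ kᵢ(kᵢ−1)(kᵢ−2)`. -/
def M3 {n : ℕ} (k : Fin n → ℕ) : ℕ := ∑ i, k i * (k i - 1) * (k i - 2)

/-- The maximum degree. -/
def kmax {n : ℕ} (k : Fin n → ℕ) : ℕ := Finset.univ.sup k

/-- `Q` is an unordered partition of the point set into parts of size `r`. -/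
def IsPartition {n : ℕ} (r : ℕ) (k : Fin n → ℕ) (Q : Finset (Finset (Pts k))) : Prop :=
  (∀ U ∈ Q, U.card = r) ∧ ∀ p : Pts k, ∃! U, U ∈ Q ∧ p ∈ U

/-- `Λ_r(k)`, the set of partitions of the points into parts of size `r`. -/
def Lam {n : ℕ} (r : ℕ) (k : Fin n → ℕ) : Set (Finset (Finset (Pts k))) :=
  {Q | IsPartition r k Q}

/-- `Λ_r(k)` as a finset. -/
noncomputable def LamFinset {n : ℕ} (r : ℕ) (k : Fin n → ℕ) :
    Finset (Finset (Finset (Pts k))) :=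
  Finset.univ.filter fun Q => IsPartition r k Q

/-- The set of vertices of the edge of `G(Q)` corresponding to a part `U`. -/
def vset {n : ℕ} {k : Fin n → ℕ} (U : Finset (Pts k)) : Finset (Fin n) :=
  U.image Sigma.fst

/-- Multiplicity of vertex `i` in the edge corresponding to a part `U`. -/
def mult {n : ℕ} {k : Fin n → ℕ} (U : Finset (Pts k)) (i : Fin n) : ℕ :=
  (U.filter fun p => p.1 = i).card

/-- `U` contains a loop: two distinct points lying in the same cell. -/
def HasLoop {n : ℕ} {k : Fin n → ℕ} (U : Finset (Pts k)) : Prop :=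
  ∃ x ∈ U, ∃ y ∈ U, x ≠ y ∧ x.1 = y.1

/-- The number of parts of `Q` which contain a loop. -/
noncomputable def nloops {n : ℕ} {k : Fin n → ℕ} (Q : Finset (Finset (Pts k))) : ℕ :=
  (Q.filter fun U => HasLoop U).card

/-- `N = max(⌈log M⌉, ⌈9(r−1)M₂/M⌉)`. -/
noncomputable def Nbound {n : ℕ} (r : ℕ) (k : Fin n → ℕ) : ℕ :=
  max ⌈Real.log (Mtot k)⌉₊ ⌈(9 * ((r : ℝ) - 1) * (M2 k : ℝ)) / (Mtot k : ℝ)⌉₊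

/-- `Λ_r⁺(k)`: partitions satisfying properties (i)–(iv). -/
noncomputable def LamPlus {n : ℕ} (r : ℕ) (k : Fin n → ℕ) :
    Set (Finset (Finset (Pts k))) :=
  {Q | IsPartition r k Q ∧
    (∀ U ∈ Q, ∀ i, mult U i ≤ 2) ∧
    (∀ U ∈ Q, ∀ i j, mult U i = 2 → mult U j = 2 → i = j) ∧
    (∀ U ∈ Q, ∀ W ∈ Q, U ≠ W → (vset U ∩ vset W).card ≤ 2) ∧
    nloops Q ≤ Nbound r k}

/-- `C_ℓ`: partitions in `Λ_r⁺(k)` with exactly `ℓ` parts containing a loop. -/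
noncomputable def Cset {n : ℕ} (r : ℕ) (k : Fin n → ℕ) (ℓ : ℕ) :
    Set (Finset (Finset (Pts k))) :=
  {Q ∈ LamPlus r k | nloops Q = ℓ}

/-- The result of an ℓ-switching replacing parts `U`, `W₁`, `W₂`. -/
def switchResult {n : ℕ} {k : Fin n → ℕ} (Q : Finset (Finset (Pts k)))
    (U W₁ W₂ : Finset (Pts k)) (x₁ x₂ y₁ y₂ : Pts k) : Finset (Finset (Pts k)) :=
  (Q \ {U, W₁, W₂}) ∪
    {(U \ {x₁, x₂}) ∪ {y₁, y₂}, (W₁ \ {y₁}) ∪ {x₁}, (W₂ \ {y₂}) ∪ {x₂}}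

/-- `(x₁,x₂,y₁,y₂)` specifies an ℓ-switching in `Q` with parts `U`, `W₁`, `W₂`. -/
def IsSwitching {n : ℕ} {k : Fin n → ℕ} (Q : Finset (Finset (Pts k)))
    (U W₁ W₂ : Finset (Pts k)) (x₁ x₂ y₁ y₂ : Pts k) : Prop :=
  U ∈ Q ∧ W₁ ∈ Q ∧ W₂ ∈ Q ∧ U ≠ W₁ ∧ U ≠ W₂ ∧ W₁ ≠ W₂ ∧
  x₁ ∈ U ∧ x₂ ∈ U ∧ x₁ ≠ x₂ ∧ x₁.1 = x₂.1 ∧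
  y₁ ∈ W₁ ∧ y₂ ∈ W₂ ∧ y₁.1 ≠ y₂.1

/-- The result of a reverse ℓ-switching replacing parts `Û`, `Ŵ₁`, `Ŵ₂`. -/
def revSwitchResult {n : ℕ} {k : Fin n → ℕ} (Q' : Finset (Finset (Pts k)))
    (Uh W₁h W₂h : Finset (Pts k)) (x₁ x₂ y₁ y₂ : Pts k) : Finset (Finset (Pts k)) :=
  (Q' \ {Uh, W₁h, W₂h}) ∪
    {(Uh \ {y₁, y₂}) ∪ {x₁, x₂}, (W₁h \ {x₁}) ∪ {y₁}, (W₂h \ {x₂}) ∪ {y₂}}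

/-- `(x₁,x₂,y₁,y₂)` specifies a reverse ℓ-switching in `Q'` with parts `Û`, `Ŵ₁`, `Ŵ₂`. -/
def IsRevSwitching {n : ℕ} {k : Fin n → ℕ} (Q' : Finset (Finset (Pts k)))
    (Uh W₁h W₂h : Finset (Pts k)) (x₁ x₂ y₁ y₂ : Pts k) : Prop :=
  Uh ∈ Q' ∧ W₁h ∈ Q' ∧ W₂h ∈ Q' ∧ Uh ≠ W₁h ∧ Uh ≠ W₂h ∧ W₁h ≠ W₂h ∧
  x₁ ∈ W₁h ∧ x₂ ∈ W₂h ∧ x₁.1 = x₂.1 ∧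
  y₁ ∈ Uh ∧ y₂ ∈ Uh ∧ y₁ ≠ y₂ ∧ y₁.1 ≠ y₂.1

/-- `Q` is simple: every edge of `G(Q)` consists of distinct vertices and all
edges are distinct. -/
def SimpleQ {n : ℕ} {k : Fin n → ℕ} (Q : Finset (Finset (Pts k))) : Prop :=
  (∀ U ∈ Q, (vset U).card = U.card) ∧
  ∀ U ∈ Q, ∀ W ∈ Q, U ≠ W → vset U ≠ vset W

/-- `|H_r(k)|`: the number of simple `r`-uniform hypergraphs on `{1,…,n}` with
degree sequence `k`, a hypergraph being recorded as its (distinct) edge set. -/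
noncomputable def Hcount (r : ℕ) {n : ℕ} (k : Fin n → ℕ) : ℕ :=
  Set.ncard {E : Finset (Finset (Fin n)) |
    (∀ e ∈ E, e.card = r) ∧ ∀ i, (E.filter fun e => i ∈ e).card = k i}

section LoopHelpers

variable {α : Type*} [Fintype α] [DecidableEq α]

/-- `Q` is a partition of the finset `S` into parts of size `r`. -/
def PartOf (r : ℕ) (S : Finset α) (Q : Finset (Finset α)) : Prop :=
  (∀ U ∈ Q, U.card = r) ∧ (∀ U ∈ Q, U ⊆ S) ∧ ∀ p ∈ S, ∃! U, U ∈ Q ∧ p ∈ U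

/-- The finset of partitions of `S` into parts of size `r`. -/
noncomputable def PS (r : ℕ) (S : Finset α) : Finset (Finset (Finset α)) :=
  Finset.univ.filter fun Q => PartOf r S Q

/-- Number of parts satisfying `L`. -/
noncomputable def nl (L : Finset α → Prop) (Q : Finset (Finset α)) : ℕ :=
  (Q.filter fun U => L U).card

/-- Number of (partition, part) pairs with `x`, `y` both in the part. -/
noncomputable def TT (r : ℕ) (S : Finset α) (x y : α) : ℕ :=
  ∑ Q ∈ PS r S, (Q.filter fun U => x ∈ U ∧ y ∈ U).card

lemma mem_PS {r : ℕ} {S : Finset α} {Q : Finset (Finset α)} :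
    Q ∈ PS r S ↔ PartOf r S Q := by
  simp [PS]

lemma PartOf.erase {r : ℕ} {S U : Finset α} {Q : Finset (Finset α)}
    (h : PartOf r S Q) (hU : U ∈ Q) : PartOf r (S \ U) (Q.erase U) := by
  obtain ⟨h1, h2, h3⟩ := h
  refine ⟨fun V hV => h1 V (Finset.mem_of_mem_erase hV), ?_, ?_⟩
  · intro V hV p hp
    have hVQ := Finset.mem_of_mem_erase hV
    refine Finset.mem_sdiff.2 ⟨h2 V hVQ hp, fun hpU => ?_⟩
    exact (Finset.ne_of_mem_erase hV) ((h3 p (h2 V hVQ hp)).unique ⟨hVQ, hp⟩ ⟨hU, hpU⟩)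
  · intro p hp
    obtain ⟨hpS, hpU⟩ := Finset.mem_sdiff.1 hp
    obtain ⟨V, ⟨hV, hpV⟩, huniq⟩ := h3 p hpS
    refine ⟨V, ⟨Finset.mem_erase.2 ⟨?_, hV⟩, hpV⟩, ?_⟩
    · rintro rfl
      exact hpU hpV
    · rintro W ⟨hW, hpW⟩
      exact huniq W ⟨Finset.mem_of_mem_erase hW, hpW⟩

lemma PartOf.insert {r : ℕ} {S U : Finset α} {Q : Finset (Finset α)}
    (h : PartOf r (S \ U) Q) (hU : U ⊆ S) (hr : U.card = r) :
    PartOf r S (insert U Q) := by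
  obtain ⟨h1, h2, h3⟩ := h
  refine ⟨?_, ?_, ?_⟩
  · intro V hV
    rcases Finset.mem_insert.1 hV with rfl | hV
    · exact hr
    · exact h1 V hV
  · intro V hV
    rcases Finset.mem_insert.1 hV with rfl | hV
    · exact hU
    · exact (h2 V hV).trans Finset.sdiff_subset
  · intro p hp
    by_cases hpU : p ∈ U
    · refine ⟨U, ⟨Finset.mem_insert_self _ _, hpU⟩, ?_⟩
      rintro W ⟨hW, hpW⟩
      rcases Finset.mem_insert.1 hW with rfl | hW
      · rfl
      · exact absurd hpU (Finset.mem_sdiff.1 (h2 W hW hpW)).2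
    · obtain ⟨V, ⟨hV, hpV⟩, huniq⟩ := h3 p (Finset.mem_sdiff.2 ⟨hp, hpU⟩)
      refine ⟨V, ⟨Finset.mem_insert_of_mem hV, hpV⟩, ?_⟩
      rintro W ⟨hW, hpW⟩
      rcases Finset.mem_insert.1 hW with rfl | hW
      · exact absurd hpW hpU
      · exact huniq W ⟨hW, hpW⟩

/-- Recursion for factorial moments. -/
lemma moment_rec (L : Finset α → Prop) {r : ℕ} (hr : 1 ≤ r) (S : Finset α) (t : ℕ) :
    ∑ Q ∈ PS r S, (nl L Q).descFactorial (t + 1)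
      = ∑ U ∈ Finset.univ.filter (fun U : Finset α => L U ∧ U.card = r ∧ U ⊆ S),
          ∑ Q ∈ PS r (S \ U), (nl L Q).descFactorial t := by
  have h1 : ∀ Q ∈ PS r S, (nl L Q).descFactorial (t + 1)
      = ∑ U ∈ Q.filter (fun U => L U), (nl L (Q.erase U)).descFactorial t := by
    intro Q _
    have h2 : ∀ U ∈ Q.filter (fun U => L U), (nl L (Q.erase U)).descFactorial t
        = (nl L Q - 1).descFactorial t := by
      intro U hU
      have : nl L (Q.erase U) = nl L Q - 1 := by
        unfold nl
        rw [Finset.filter_erase, Finset.card_erase_of_mem hU]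
      rw [this]
    rw [Finset.sum_congr rfl h2, Finset.sum_const, smul_eq_mul]
    change _ = nl L Q * _
    rcases Nat.eq_zero_or_pos (nl L Q) with h0 | h0
    · simp [h0]
    · obtain ⟨m, hm⟩ : ∃ m, nl L Q = m + 1 := ⟨nl L Q - 1, by omega⟩
      rw [hm, Nat.succ_descFactorial_succ]
      simp
  rw [Finset.sum_congr rfl h1, Finset.sum_sigma', Finset.sum_sigma']
  refine Finset.sum_bij' (fun a _ => ⟨a.2, a.1.erase a.2⟩) (fun b _ => ⟨insert b.1 b.2, b.1⟩)
    ?_ ?_ ?_ ?_ ?_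
  · rintro ⟨Q, U⟩ h
    simp only [Finset.mem_sigma, mem_PS, Finset.mem_filter, Finset.mem_univ, true_and] at h ⊢
    obtain ⟨hQ, hU, hL⟩ := h
    exact ⟨⟨hL, hQ.1 U hU, hQ.2.1 U hU⟩, hQ.erase hU⟩
  · rintro ⟨U, Q⟩ h
    simp only [Finset.mem_sigma, mem_PS, Finset.mem_filter, Finset.mem_univ, true_and] at h ⊢
    obtain ⟨⟨hL, hc, hS⟩, hQ⟩ := h
    exact ⟨hQ.insert hS hc, Finset.mem_insert_self _ _, hL⟩
  · rintro ⟨Q, U⟩ h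
    simp only [Finset.mem_sigma, mem_PS, Finset.mem_filter] at h
    simp [Finset.insert_erase h.2.1]
  · rintro ⟨U, Q⟩ h
    simp only [Finset.mem_sigma, mem_PS, Finset.mem_filter, Finset.mem_univ, true_and] at h
    obtain ⟨⟨hL, hc, hS⟩, hQ⟩ := h
    have hnot : U ∉ Q := by
      intro hU
      obtain ⟨p, hp⟩ : U.Nonempty := Finset.card_pos.1 (by omega)
      exact (Finset.mem_sdiff.1 (hQ.2.1 U hU hp)).2 hp
    simp [Finset.erase_insert hnot]
  · rintro ⟨Q, U⟩ h
    rfl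

/-- Transport of a partition by a permutation fixing `S`. -/
lemma PartOf.map {r : ℕ} {S : Finset α} {Q : Finset (Finset α)} (h : PartOf r S Q)
    (σ : Equiv.Perm α) (hσ : ∀ p, p ∈ S ↔ σ p ∈ S) :
    PartOf r S (Q.map (Finset.mapEmbedding σ.toEmbedding).toEmbedding) := by
  obtain ⟨h1, h2, h3⟩ := h
  refine ⟨?_, ?_, ?_⟩
  · intro V hV
    obtain ⟨U, hU, rfl⟩ := Finset.mem_map.1 hV
    simpa using h1 U hU
  · intro V hV
    obtain ⟨U, hU, rfl⟩ := Finset.mem_map.1 hV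
    intro p hp
    obtain ⟨q, hq, rfl⟩ := Finset.mem_map.1 (by simpa using hp : p ∈ U.map σ.toEmbedding)
    exact (hσ q).1 (h2 U hU hq)
  · intro p hp
    have hp' : σ.symm p ∈ S := by rw [hσ]; simpa using hp
    obtain ⟨V, ⟨hV, hpV⟩, huniq⟩ := h3 _ hp'
    refine ⟨V.map σ.toEmbedding, ⟨Finset.mem_map.2 ⟨V, hV, by simp⟩, ?_⟩, ?_⟩
    · exact Finset.mem_map.2 ⟨_, hpV, by simp⟩
    · rintro W ⟨hW, hpW⟩
      obtain ⟨U, hU, rfl⟩ := Finset.mem_map.1 hW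
      obtain ⟨q, hq, hqp⟩ := Finset.mem_map.1 (by simpa using hpW : p ∈ U.map σ.toEmbedding)
      have : σ.symm p = q := by rw [← hqp]; simp
      rw [huniq U ⟨hU, this ▸ hq⟩]
      simp

lemma TT_le {r : ℕ} {S : Finset α} {x y z : α} (hy : y ∈ S) (hz : z ∈ S)
    (hxy : x ≠ y) (hxz : x ≠ z) : TT r S x y ≤ TT r S x z := by
  set σ : Equiv.Perm α := Equiv.swap y z with hσdef
  have hσ : ∀ p, p ∈ S ↔ σ p ∈ S := by
    intro p
    rw [hσdef, Equiv.swap_apply_def]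
    split_ifs with h1 h2
    · subst h1; simp [hy, hz]
    · subst h2; simp [hy, hz]
    · rfl
  set e := (Finset.mapEmbedding σ.toEmbedding).toEmbedding with he
  unfold TT
  have hcard : ∀ Q ∈ PS r S, (Q.filter fun U => x ∈ U ∧ y ∈ U).card
      ≤ ((Q.map e).filter fun U => x ∈ U ∧ z ∈ U).card := by
    intro Q _
    rw [← Finset.card_map e]
    apply Finset.card_le_card
    intro V hV
    obtain ⟨U, hU, rfl⟩ := Finset.mem_map.1 hV
    obtain ⟨hUQ, hxU, hyU⟩ := Finset.mem_filter.1 hU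
    refine Finset.mem_filter.2 ⟨Finset.mem_map_of_mem _ hUQ, ?_, ?_⟩
    · refine Finset.mem_map.2 ⟨x, hxU, ?_⟩
      exact Equiv.swap_apply_of_ne_of_ne hxy hxz
    · refine Finset.mem_map.2 ⟨y, hyU, ?_⟩
      exact Equiv.swap_apply_left y z
  refine (Finset.sum_le_sum hcard).trans ?_
  have hinj : Function.Injective fun Q : Finset (Finset α) => Q.map e :=
    Finset.map_injective e
  have := Finset.sum_image (s := PS r S) (g := fun Q : Finset (Finset α) => Q.map e)
    (f := fun Q => (Q.filter fun U => x ∈ U ∧ z ∈ U).card) (fun a _ b _ h => hinj h)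
  rw [← this]
  apply Finset.sum_le_sum_of_subset
  intro Q hQ
  obtain ⟨Q', hQ', rfl⟩ := Finset.mem_image.1 hQ
  exact mem_PS.2 ((mem_PS.1 hQ').map σ hσ)

lemma TT_sum {r : ℕ} {S : Finset α} {x : α} (hx : x ∈ S) :
    ∑ y ∈ S.erase x, TT r S x y = (r - 1) * (PS r S).card := by
  unfold TT
  rw [Finset.sum_comm]
  have : ∀ Q ∈ PS r S, ∑ y ∈ S.erase x, (Q.filter fun U => x ∈ U ∧ y ∈ U).card = r - 1 := by
    intro Q hQ
    obtain ⟨h1, h2, h3⟩ := mem_PS.1 hQ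
    obtain ⟨V, ⟨hV, hxV⟩, huniq⟩ := h3 x hx
    have h4 : ∀ y ∈ S.erase x, (Q.filter fun U => x ∈ U ∧ y ∈ U).card
        = if y ∈ V.erase x then 1 else 0 := by
      intro y hy
      have hyx := Finset.ne_of_mem_erase hy
      split_ifs with h
      · rw [Finset.card_eq_one]
        refine ⟨V, ?_⟩
        ext U
        simp only [Finset.mem_filter, Finset.mem_singleton]
        constructor
        · rintro ⟨a, b, c⟩
          exact huniq U ⟨a, b⟩
        · rintro rfl
          exact ⟨hV, hxV, Finset.mem_of_mem_erase h⟩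
      · rw [Finset.card_eq_zero, Finset.filter_eq_empty_iff]
        rintro U hU ⟨a, b⟩
        have := huniq U ⟨hU, a⟩
        subst this
        exact h (Finset.mem_erase.2 ⟨hyx, b⟩)
    rw [Finset.sum_congr rfl h4, Finset.sum_ite_mem, Finset.sum_const, smul_eq_mul, mul_one,
      Finset.inter_eq_right.2 (Finset.erase_subset_erase x (h2 V hV)),
      Finset.card_erase_of_mem hxV, h1 V hV]
  rw [Finset.sum_congr rfl this, Finset.sum_const, smul_eq_mul, mul_comm]

lemma TT_eq {r : ℕ} {S : Finset α} {x y : α} (hx : x ∈ S) (hy : y ∈ S) (hxy : x ≠ y) :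
    (S.card - 1) * TT r S x y = (r - 1) * (PS r S).card := by
  rw [← TT_sum hx, ← Finset.card_erase_of_mem hx, ← smul_eq_mul, ← Finset.sum_const]
  refine Finset.sum_congr rfl fun z hz => ?_
  have hzx := Finset.ne_of_mem_erase hz
  have hzS := Finset.mem_of_mem_erase hz
  exact le_antisymm (TT_le hy hzS hxy hzx.symm) (TT_le hzS hy hzx.symm hxy)

/-- First moment bound. -/
lemma first_moment (L : Finset α → Prop) (E : Finset (α × α)) (hE : ∀ e ∈ E, e.1 ≠ e.2)
    (hL : ∀ U, L U → 2 ≤ (E.filter fun e => e.1 ∈ U ∧ e.2 ∈ U).card)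
    (r : ℕ) (S : Finset α) :
    (S.card - 1) * (2 * ∑ Q ∈ PS r S, nl L Q) ≤ E.card * ((r - 1) * (PS r S).card) := by
  have h1 : 2 * ∑ Q ∈ PS r S, nl L Q
      ≤ ∑ e ∈ E.filter (fun e => e.1 ∈ S ∧ e.2 ∈ S), TT r S e.1 e.2 := by
    unfold TT
    rw [Finset.mul_sum, Finset.sum_comm]
    refine Finset.sum_le_sum fun Q hQ => ?_
    obtain ⟨_, h2, _⟩ := mem_PS.1 hQ
    have h5 : ∑ e ∈ E.filter (fun e => e.1 ∈ S ∧ e.2 ∈ S),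
          (Q.filter fun U => e.1 ∈ U ∧ e.2 ∈ U).card
        = ∑ U ∈ Q, ((E.filter (fun e => e.1 ∈ S ∧ e.2 ∈ S)).filter
            fun e => e.1 ∈ U ∧ e.2 ∈ U).card := by
      have h7 := Finset.sum_card_bipartiteAbove_eq_sum_card_bipartiteBelow
        (s := E.filter (fun e => e.1 ∈ S ∧ e.2 ∈ S)) (t := Q)
        (fun (e : α × α) (U : Finset α) => e.1 ∈ U ∧ e.2 ∈ U)
      simp only [Finset.bipartiteAbove, Finset.bipartiteBelow] at h7
      convert h7
    rw [h5]
    unfold nl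
    rw [mul_comm, ← smul_eq_mul, ← Finset.sum_const]
    refine (Finset.sum_le_sum fun U hU => ?_).trans
      (Finset.sum_le_sum_of_subset (Finset.filter_subset (fun U => L U) Q))
    obtain ⟨hUQ, hLU⟩ := Finset.mem_filter.1 hU
    refine (hL U hLU).trans (Finset.card_le_card ?_)
    intro e he
    obtain ⟨he1, he2, he3⟩ := Finset.mem_filter.1 he
    simp only [Finset.mem_filter]
    exact ⟨⟨he1, h2 U hUQ he2, h2 U hUQ he3⟩, he2, he3⟩
  refine (Nat.mul_le_mul_left _ h1).trans ?_
  rw [Finset.mul_sum]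
  have h6 : ∀ e ∈ E.filter (fun e => e.1 ∈ S ∧ e.2 ∈ S),
      (S.card - 1) * TT r S e.1 e.2 = (r - 1) * (PS r S).card := by
    intro e he
    obtain ⟨he1, he2, he3⟩ := Finset.mem_filter.1 he
    exact TT_eq he2 he3 (hE e he1)
  rw [Finset.sum_congr rfl h6, Finset.sum_const, smul_eq_mul]
  exact Nat.mul_le_mul_right _ (Finset.card_le_card (Finset.filter_subset _ _))

/-- Factorial moment bound. -/
lemma moment_bound (L : Finset α → Prop) (E : Finset (α × α)) (hE : ∀ e ∈ E, e.1 ≠ e.2)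
    (hL : ∀ U, L U → 2 ≤ (E.filter fun e => e.1 ∈ U ∧ e.2 ∈ U).card)
    (r : ℕ) (hr : 1 ≤ r) (D : ℝ) (hD : 0 < D) (t : ℕ) :
    ∀ S : Finset α, D + r * t ≤ S.card →
      ((∑ Q ∈ PS r S, (nl L Q).descFactorial t : ℕ) : ℝ) * D ^ t
        ≤ ((E.card : ℝ) * ((r : ℝ) - 1) / 2) ^ t * (PS r S).card := by
  have hr' : (1 : ℝ) ≤ r := by exact_mod_cast hr
  have hc : 0 ≤ (E.card : ℝ) * ((r : ℝ) - 1) / 2 := by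
    have : (0 : ℝ) ≤ (r : ℝ) - 1 := by linarith
    positivity
  induction t with
  | zero => intro S _; simp
  | succ t ih =>
    intro S hS
    set c := (E.card : ℝ) * ((r : ℝ) - 1) / 2 with hcdef
    have hrec := moment_rec L hr S t
    have hrec0 := moment_rec L hr S 0
    simp only [zero_add, Nat.descFactorial_one, Nat.descFactorial_zero, Finset.sum_const,
      smul_eq_mul, mul_one] at hrec0
    set 𝒰 := Finset.univ.filter (fun U : Finset α => L U ∧ U.card = r ∧ U ⊆ S) with h𝒰
    have h1 : ((∑ Q ∈ PS r S, (nl L Q).descFactorial (t + 1) : ℕ) : ℝ) * D ^ t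
        ≤ c ^ t * ((∑ Q ∈ PS r S, nl L Q : ℕ) : ℝ) := by
      rw [hrec, hrec0, Nat.cast_sum, Nat.cast_sum, Finset.sum_mul, Finset.mul_sum]
      refine Finset.sum_le_sum fun U hU => ?_
      obtain ⟨_, _, hUc, hUS⟩ := Finset.mem_filter.1 hU
      apply ih
      rw [Finset.cast_card_sdiff hUS, hUc]
      push_cast at hS
      linarith
    have hfm := first_moment L E hE hL r S
    have hS1 : D ≤ (S.card : ℝ) - 1 := by
      push_cast at hS
      have : (0 : ℝ) ≤ r * t := by positivity
      nlinarith
    have hS2 : 1 ≤ S.card := by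
      have : (1 : ℝ) ≤ S.card := by linarith
      exact_mod_cast this
    have hfm' : ((S.card : ℝ) - 1) * (2 * ((∑ Q ∈ PS r S, nl L Q : ℕ) : ℝ))
        ≤ E.card * (((r : ℝ) - 1) * (PS r S).card) := by
      have := (Nat.cast_le (α := ℝ)).2 hfm
      rw [Nat.cast_mul, Nat.cast_mul, Nat.cast_mul, Nat.cast_mul, Nat.cast_sub hS2,
        Nat.cast_sub hr] at this
      simpa using this
    have h2 : D * ((∑ Q ∈ PS r S, nl L Q : ℕ) : ℝ) ≤ c * (PS r S).card := by
      have h3 : D * ((∑ Q ∈ PS r S, nl L Q : ℕ) : ℝ)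
          ≤ ((S.card : ℝ) - 1) * ((∑ Q ∈ PS r S, nl L Q : ℕ) : ℝ) :=
        mul_le_mul_of_nonneg_right hS1 (Nat.cast_nonneg _)
      rw [hcdef]
      linarith
    calc _ = (((∑ Q ∈ PS r S, (nl L Q).descFactorial (t + 1) : ℕ) : ℝ) * D ^ t) * D := by ring
      _ ≤ (c ^ t * ((∑ Q ∈ PS r S, nl L Q : ℕ) : ℝ)) * D :=
          mul_le_mul_of_nonneg_right h1 hD.le
      _ = c ^ t * (D * ((∑ Q ∈ PS r S, nl L Q : ℕ) : ℝ)) := by ring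
      _ ≤ c ^ t * (c * (PS r S).card) := mul_le_mul_of_nonneg_left h2 (by positivity)
      _ = _ := by ring

/-- Markov inequality form. -/
lemma markov_bound (L : Finset α → Prop) (E : Finset (α × α)) (hE : ∀ e ∈ E, e.1 ≠ e.2)
    (hL : ∀ U, L U → 2 ≤ (E.filter fun e => e.1 ∈ U ∧ e.2 ∈ U).card)
    (r : ℕ) (hr : 1 ≤ r) (D : ℝ) (hD : 0 < D) (t : ℕ) (S : Finset α)
    (hS : D + r * t ≤ S.card) :
    (((PS r S).filter fun Q => t < nl L Q).card : ℝ) * t.factorial * D ^ t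
        ≤ ((E.card : ℝ) * ((r : ℝ) - 1) / 2) ^ t * (PS r S).card := by
  refine le_trans ?_ (moment_bound L E hE hL r hr D hD t S hS)
  refine mul_le_mul_of_nonneg_right ?_ (by positivity)
  rw [← Nat.cast_mul, Nat.cast_le, ← smul_eq_mul, ← Finset.sum_const]
  refine (Finset.sum_le_sum fun Q hQ => ?_).trans
    (Finset.sum_le_sum_of_subset (Finset.filter_subset (fun Q => t < nl L Q) (PS r S)))
  have h := (Finset.mem_filter.1 hQ).2
  rw [Nat.descFactorial_eq_factorial_mul_choose]
  exact Nat.le_mul_of_pos_right _ (Nat.choose_pos h.le)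

end LoopHelpers

/-- Ordered pairs of distinct points in the same cell. -/
noncomputable def loopPairs {n : ℕ} (k : Fin n → ℕ) : Finset (Pts k × Pts k) :=
  Finset.univ.filter fun e => e.1 ≠ e.2 ∧ e.1.1 = e.2.1

lemma card_loopPairs {n : ℕ} (k : Fin n → ℕ) : (loopPairs k).card = M2 k := by
  have h1 : (loopPairs k).card = ∑ x : Pts k, (k x.1 - 1) := by
    unfold loopPairs
    rw [Finset.card_filter, Fintype.sum_prod_type]
    refine Finset.sum_congr rfl fun x _ => ?_
    rw [← Finset.card_filter]
    have : (Finset.univ.filter fun y : Pts k => x ≠ y ∧ x.1 = y.1)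
        = (Finset.univ.image fun j : Fin (k x.1) => (⟨x.1, j⟩ : Pts k)).erase x := by
      ext ⟨a, b⟩
      obtain ⟨i, j⟩ := x
      simp only [Finset.mem_filter, Finset.mem_univ, true_and, Finset.mem_erase,
        Finset.mem_image]
      constructor
      · rintro ⟨h, rfl⟩
        exact ⟨h.symm, b, rfl⟩
      · rintro ⟨h, c, hc⟩
        exact ⟨h.symm, congrArg Sigma.fst hc⟩
    rw [this, Finset.card_erase_of_mem, Finset.card_image_of_injective]
    · simp
    · intro a b h
      simpa using h
    · exact Finset.mem_image.2 ⟨x.2, Finset.mem_univ _, rfl⟩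
  rw [h1, Fintype.sum_sigma]
  simp [M2]

lemma two_le_loopPairs {n : ℕ} (k : Fin n → ℕ) (U : Finset (Pts k)) (h : HasLoop U) :
    2 ≤ ((loopPairs k).filter fun e => e.1 ∈ U ∧ e.2 ∈ U).card := by
  obtain ⟨x, hx, y, hy, hxy, hc⟩ := h
  have : ({(x, y), (y, x)} : Finset (Pts k × Pts k)).card = 2 := by
    apply Finset.card_pair
    intro h
    exact hxy (Prod.ext_iff.1 h).1
  rw [← this]
  apply Finset.card_le_card
  intro e he
  simp only [Finset.mem_insert, Finset.mem_singleton] at he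
  rcases he with rfl | rfl
  · simp [loopPairs, hx, hy, hxy, hc]
  · simp [loopPairs, hx, hy, hxy.symm, hc]

lemma M2_le {n : ℕ} (k : Fin n → ℕ) : M2 k ≤ kmax k * Mtot k := by
  unfold M2 Mtot
  rw [Finset.mul_sum]
  refine Finset.sum_le_sum fun i _ => ?_
  rw [mul_comm]
  refine Nat.mul_le_mul_right _ ((Nat.sub_le _ _).trans ?_)
  exact Finset.le_sup (f := k) (Finset.mem_univ i)

lemma partOf_univ {n : ℕ} (r : ℕ) (k : Fin n → ℕ) (Q : Finset (Finset (Pts k))) :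
    PartOf r Finset.univ Q ↔ IsPartition r k Q := by
  simp [PartOf, IsPartition]

/-- Numerical estimate showing that `N` is small compared with `M`. -/
lemma N_small (r : ℕ) (hr : 3 ≤ r) {n : ℕ} (k : Fin n → ℕ)
    (hM : (36 * r ^ 2) ^ 2 ≤ Mtot k) (hk : (kmax k : ℝ) ^ 3 ≤ 1 * (Mtot k : ℝ)) :
    (Mtot k : ℝ) / 2 + r * (Nbound r k : ℕ) ≤ Mtot k := by
  set M : ℝ := (Mtot k : ℝ) with hMdef
  set K : ℝ := (kmax k : ℝ) with hKdef
  have hr' : (3 : ℝ) ≤ r := by exact_mod_cast hr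
  have hM' : (36 * (r : ℝ) ^ 2) ^ 2 ≤ M := by rw [hMdef]; exact_mod_cast hM
  have hA : (0 : ℝ) < 36 * (r : ℝ) ^ 2 := by positivity
  have hA1 : (1 : ℝ) ≤ 36 * (r : ℝ) ^ 2 := by nlinarith
  have hMpos : 0 < M := lt_of_lt_of_le (by positivity) hM'
  have hK0 : 0 ≤ K := Nat.cast_nonneg _
  set s := Real.sqrt M with hs
  have hss : s * s = M := Real.mul_self_sqrt hMpos.le
  have hsA : 36 * (r : ℝ) ^ 2 ≤ s := Real.le_sqrt_of_sq_le hM'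
  have hKs : K ≤ s := by
    by_contra h
    push Not at h
    have h1 : s ^ 3 < K ^ 3 := pow_lt_pow_left₀ h (by linarith) (by norm_num)
    nlinarith
  have hlog : Real.log M ≤ 2 * s := by
    have : Real.log s ≤ s := (Real.log_le_sub_one_of_pos (by linarith)).trans (by linarith)
    rw [← hss, Real.log_mul (by linarith) (by linarith)]
    linarith
  have hM2 : 9 * ((r : ℝ) - 1) * (M2 k : ℝ) / M ≤ 9 * ((r : ℝ) - 1) * s := by
    rw [div_le_iff₀ hMpos]
    have : (M2 k : ℝ) ≤ K * M := by rw [hMdef, hKdef]; exact_mod_cast M2_le k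
    have h2 : (M2 k : ℝ) ≤ s * M := this.trans (mul_le_mul_of_nonneg_right hKs hMpos.le)
    have h3 : (0 : ℝ) ≤ 9 * ((r : ℝ) - 1) := by linarith
    nlinarith [mul_le_mul_of_nonneg_left h2 h3]
  have hN : (Nbound r k : ℝ) ≤ 9 * ((r : ℝ) - 1) * s + 1 := by
    unfold Nbound
    rw [Nat.cast_max]
    apply max_le
    · refine (Nat.ceil_lt_add_one (Real.log_nonneg (by nlinarith))).le.trans ?_
      nlinarith
    · refine (Nat.ceil_lt_add_one ?_).le.trans (by linarith)
      have h3 : (0 : ℝ) ≤ 9 * ((r : ℝ) - 1) := by linarith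
      positivity
  have h7 : (r : ℝ) * (Nbound r k : ℝ) ≤ r * (9 * ((r : ℝ) - 1) * s + 1) :=
    mul_le_mul_of_nonneg_left hN (by linarith)
  have h8 : (r : ℝ) * (9 * ((r : ℝ) - 1) * s + 1) ≤ 9 * r ^ 2 * s := by nlinarith
  have h9 : 36 * (r : ℝ) ^ 2 * s ≤ s * s := mul_le_mul_of_nonneg_right hsA (by linarith)
  nlinarith

lemma exp_estimate (N : ℕ) (M a : ℝ) (hM : 0 < M) (ha : 0 ≤ a) (h1 : Real.log M ≤ N)
    (h2 : 9 * a ≤ N) : a ^ N ≤ (1 / M) * N.factorial := by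
  have hf : (0 : ℝ) < N.factorial := by exact_mod_cast N.factorial_pos
  have h3 : (N : ℝ) ^ N / N.factorial ≤ Real.exp N :=
    Real.pow_div_factorial_le_exp (N : ℝ) (Nat.cast_nonneg _) N
  rw [div_le_iff₀ hf] at h3
  have h4 : M ≤ Real.exp N := by
    rw [← Real.exp_log hM]; exact Real.exp_le_exp.2 h1
  have he : Real.exp 1 ^ 2 ≤ 9 := by
    have := Real.exp_one_lt_d9
    have h0 := Real.exp_pos 1
    nlinarith
  have hE : Real.exp N * Real.exp N ≤ 9 ^ N := by
    rw [← Real.exp_one_pow, ← mul_pow, ← sq]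
    exact pow_le_pow_left₀ (by positivity) he N
  have h5 : 9 ^ N * a ^ N ≤ Real.exp N * N.factorial := by
    rw [← mul_pow]
    exact (pow_le_pow_left₀ (by positivity) h2 N).trans h3
  have hEp := Real.exp_pos (N : ℝ)
  have h6 : Real.exp N * a ^ N ≤ N.factorial := by
    have : Real.exp N * (Real.exp N * a ^ N) ≤ Real.exp N * N.factorial := by
      refine le_trans ?_ h5
      rw [← mul_assoc]
      exact mul_le_mul_of_nonneg_right hE (by positivity)
    exact le_of_mul_le_mul_left this hEp
  rw [one_div, inv_mul_eq_div, le_div_iff₀ hM, mul_comm]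
  exact (mul_le_mul_of_nonneg_right h4 (by positivity)).trans h6

/-- the probability that more than N parts contain a loop is
O(1/M). -/
theorem probability_many_loops (r : ℕ) (hr : 3 ≤ r) :
    ∃ C δ : ℝ, ∃ M₀ : ℕ, 0 < C ∧ 0 < δ ∧
      ∀ (n : ℕ) (k : Fin n → ℕ),
        M₀ ≤ Mtot k → r ∣ Mtot k → 2 ≤ kmax k → (kmax k : ℝ) ^ 3 ≤ δ * (Mtot k : ℝ) →
        (Set.ncard {Q ∈ Lam r k | Nbound r k < nloops Q} : ℝ) /
            (Set.ncard (Lam r k) : ℝ) ≤ C / (Mtot k : ℝ) := by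
  refine ⟨1, 1, (36 * r ^ 2) ^ 2, one_pos, one_pos, ?_⟩
  intro n k hM _ _ hk
  have hr' : (3 : ℝ) ≤ r := by exact_mod_cast hr
  have hMpos : (0 : ℝ) < Mtot k := by
    have h0 : 0 < (36 * r ^ 2) ^ 2 := by positivity
    exact_mod_cast lt_of_lt_of_le h0 hM
  have hcard : (Finset.univ : Finset (Pts k)).card = Mtot k := by
    simp [Mtot]
  have hmain := markov_bound (fun U : Finset (Pts k) => HasLoop U) (loopPairs k)
    (fun e he => (Finset.mem_filter.1 he).2.1) (two_le_loopPairs k) r (by omega)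
    ((Mtot k : ℝ) / 2) (by positivity) (Nbound r k) Finset.univ
    (by rw [hcard]; exact N_small r hr k hM hk)
  rw [card_loopPairs] at hmain
  have hLam : Set.ncard (Lam r k) = (PS r (Finset.univ : Finset (Pts k))).card := by
    rw [← Set.ncard_coe_finset]
    congr 1
    ext Q
    simp only [Lam, Set.mem_ofPred_eq, Finset.mem_coe, mem_PS]
    exact (partOf_univ r k Q).symm
  have hBad : Set.ncard {Q ∈ Lam r k | Nbound r k < nloops Q}
      = ((PS r (Finset.univ : Finset (Pts k))).filter
          fun Q => Nbound r k < nl (fun U : Finset (Pts k) => HasLoop U) Q).card := by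
    rw [← Set.ncard_coe_finset]
    congr 1
    ext Q
    simp only [Lam, Set.mem_ofPred_eq, Finset.mem_coe, mem_PS, Finset.mem_filter, partOf_univ]
    rfl
  rw [hLam, hBad]
  set A := (((PS r (Finset.univ : Finset (Pts k))).filter
          fun Q => Nbound r k < nl (fun U : Finset (Pts k) => HasLoop U) Q).card : ℝ) with hA
  set P := ((PS r (Finset.univ : Finset (Pts k))).card : ℝ) with hP
  set N := Nbound r k with hN
  have hP0 : 0 ≤ P := Nat.cast_nonneg _
  have hest := exp_estimate N (Mtot k) ((M2 k : ℝ) * ((r : ℝ) - 1) / Mtot k) hMpos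
    (by
      have : (0 : ℝ) ≤ (r : ℝ) - 1 := by linarith
      positivity)
    (by
      refine (Nat.le_ceil _).trans ?_
      exact Nat.cast_le.2 (le_max_left _ _))
    (by
      have h1 : 9 * ((M2 k : ℝ) * ((r : ℝ) - 1) / Mtot k)
          = (9 * ((r : ℝ) - 1) * (M2 k : ℝ)) / (Mtot k : ℝ) := by ring
      rw [h1]
      refine (Nat.le_ceil _).trans ?_
      exact Nat.cast_le.2 (le_max_right _ _))
  have hf : (0 : ℝ) < N.factorial := by exact_mod_cast N.factorial_pos
  have hkey : A * N.factorial ≤ ((1 / (Mtot k : ℝ)) * P) * N.factorial := by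
    have hD : (0 : ℝ) < ((Mtot k : ℝ) / 2) ^ N := by positivity
    have hc : ((M2 k : ℝ) * ((r : ℝ) - 1) / 2) ^ N
        = ((M2 k : ℝ) * ((r : ℝ) - 1) / Mtot k) ^ N * ((Mtot k : ℝ) / 2) ^ N := by
      rw [← mul_pow]
      congr 1
      field_simp
    rw [hc] at hmain
    have h2 : A * N.factorial ≤ ((M2 k : ℝ) * ((r : ℝ) - 1) / Mtot k) ^ N * P := by
      refine le_of_mul_le_mul_right ?_ hD
      linarith
    refine h2.trans ((mul_le_mul_of_nonneg_right hest hP0).trans (le_of_eq ?_))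
    ring
  have hAP := le_of_mul_le_mul_right hkey hf
  exact div_le_of_le_mul₀ hP0 (by positivity) hAP
end

section
/- Let r ≥ 3 be fixed. There exist constants C > 0 and δ > 0 depending only on r such that for every degree sequence k with sum M divisible by r, k_max ≥ 2 and k_max^3 ≤ δM, and for every integer ℓ with 1 ≤ ℓ ≤ N and every Q' ∈ C_{ℓ−1}, the number of 4-tuples (x_1,x_2,y_1,y_2) specifying a legal reverse ℓ-switching in Q' equals (r−1)·M·M_2·(1 + E) for some real E with |E| ≤ C·(k_max^3 + ℓ·k_max)/M_2. -/
open scoped Classical BigOperators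

/-- The set of 4-tuples specifying a legal reverse ℓ-switching in `Q'`. -/
def legalReverseTuples {n : ℕ} (r : ℕ) (k : Fin n → ℕ) (ℓ : ℕ)
    (Q' : Finset (Finset (Pts k))) : Set (Pts k × Pts k × Pts k × Pts k) :=
  {t | ∃ Uh W₁h W₂h, IsRevSwitching Q' Uh W₁h W₂h t.1 t.2.1 t.2.2.1 t.2.2.2 ∧
    revSwitchResult Q' Uh W₁h W₂h t.1 t.2.1 t.2.2.1 t.2.2.2 ∈ Cset r k ℓ}

section helpers

variable {n : ℕ} {k : Fin n → ℕ}

def NoLoop (U : Finset (Pts k)) : Prop := ∀ x ∈ U, ∀ y ∈ U, x.1 = y.1 → x = y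

lemma not_hasLoop_iff (U : Finset (Pts k)) : ¬ HasLoop U ↔ NoLoop U := by
  unfold HasLoop NoLoop
  push Not
  constructor
  · intro h x hx y hy hxy
    by_contra hne
    exact h x hx y hy hne hxy
  · intro h x hx y hy hne hxy
    exact hne (h x hx y hy hxy)

lemma mult_le_one {U : Finset (Pts k)} (h : NoLoop U) (i : Fin n) : mult U i ≤ 1 := by
  unfold mult
  rw [Finset.card_le_one]
  intro a ha b hb
  simp only [Finset.mem_filter] at ha hb
  exact h a ha.1 b hb.1 (ha.2.trans hb.2.symm)

lemma mem_vset {U : Finset (Pts k)} {i : Fin n} : i ∈ vset U ↔ ∃ p ∈ U, p.1 = i := by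
  unfold vset
  simp only [Finset.mem_image]

lemma exists_part {r : ℕ} {Q : Finset (Finset (Pts k))} (h : IsPartition r k Q) :
    ∃ P : Pts k → Finset (Pts k), (∀ p, P p ∈ Q) ∧ (∀ U ∈ Q, ∀ p, p ∈ U ↔ P p = U) := by
  choose P hP using h.2
  refine ⟨P, fun p => (hP p).1.1, fun U hU p => ⟨fun hp => ((hP p).2 U ⟨hU, hp⟩).symm, ?_⟩⟩
  rintro rfl
  exact (hP p).1.2

lemma legal_of_good {r ℓ : ℕ} {Q : Finset (Finset (Pts k))} (hℓ1 : 1 ≤ ℓ)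
    (hℓ : ℓ ≤ Nbound r k) (hQ : Q ∈ Cset r k (ℓ - 1)) (P : Pts k → Finset (Pts k))
    (hP : ∀ p, P p ∈ Q) (hPm : ∀ U ∈ Q, ∀ p, p ∈ U ↔ P p = U)
    (x₁ x₂ y₁ y₂ : Pts k) (hx : x₁ ≠ x₂) (hxc : x₁.1 = x₂.1) (hy : y₁ ≠ y₂)
    (hyP : P y₁ = P y₂)
    (nU : NoLoop (P y₁)) (nW₁ : NoLoop (P x₁)) (nW₂ : NoLoop (P x₂))
    (H : ∀ a b c d, P a = P y₁ → a.1 = b.1 → P b = P c → c.1 = d.1 →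
      P d ≠ P x₁ ∧ P d ≠ P x₂) :
    (x₁, x₂, y₁, y₂) ∈ legalReverseTuples r k ℓ Q := by
  obtain ⟨⟨⟨hcard, hex⟩, hm2, hmu, hint, hnl⟩, hnl'⟩ := hQ
  have hmem : ∀ p q, p ∈ P q ↔ P p = P q := fun p q => hPm _ (hP q) p
  -- cell-disjointness
  have D1 : ∀ a b, P a = P y₁ → a.1 = b.1 → P b ≠ P x₁ ∧ P b ≠ P x₂ :=
    fun a b h1 h2 => H a b b b h1 h2 rfl rfl
  have hUW₁ : P y₁ ≠ P x₁ := (D1 y₁ y₁ rfl rfl).1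
  have hUW₂ : P y₁ ≠ P x₂ := (D1 y₁ y₁ rfl rfl).2
  have hWW : P x₁ ≠ P x₂ := fun h =>
    hx (nW₁ x₁ ((hmem _ _).2 rfl) x₂ ((hmem _ _).2 h.symm) hxc)
  have hyc : y₁.1 ≠ y₂.1 := fun h =>
    hy (nU y₁ ((hmem _ _).2 rfl) y₂ ((hmem _ _).2 hyP.symm) h)
  refine ⟨P y₁, P x₁, P x₂, ⟨hP _, hP _, hP _, hUW₁, hUW₂, hWW, (hmem _ _).2 rfl,
    (hmem _ _).2 rfl, hxc, (hmem _ _).2 rfl, (hmem _ _).2 hyP.symm, hy, hyc⟩, ?_⟩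
  simp only [revSwitchResult]
  obtain ⟨A, hA⟩ : ∃ A, A = (P y₁ \ {y₁, y₂}) ∪ {x₁, x₂} := ⟨_, rfl⟩
  obtain ⟨B₁, hB₁⟩ : ∃ A, A = (P x₁ \ {x₁}) ∪ {y₁} := ⟨_, rfl⟩
  obtain ⟨B₂, hB₂⟩ : ∃ A, A = (P x₂ \ {x₂}) ∪ {y₂} := ⟨_, rfl⟩
  rw [← hA, ← hB₁, ← hB₂]
  have mA : ∀ p, p ∈ A ↔ (P p = P y₁ ∧ p ≠ y₁ ∧ p ≠ y₂) ∨ p = x₁ ∨ p = x₂ := by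
    intro p; simp [hA, hmem]; tauto
  have mB₁ : ∀ p, p ∈ B₁ ↔ (P p = P x₁ ∧ p ≠ x₁) ∨ p = y₁ := by
    intro p; simp [hB₁, hmem]; tauto
  have mB₂ : ∀ p, p ∈ B₂ ↔ (P p = P x₂ ∧ p ≠ x₂) ∨ p = y₂ := by
    intro p; simp [hB₂, hmem]; tauto
  have nB₁ : NoLoop B₁ := by
    intro a ha b hb hab
    rw [mB₁] at ha hb
    rcases ha with ⟨ha, -⟩ | rfl <;> rcases hb with ⟨hb, -⟩ | rfl
    · exact nW₁ a ((hmem _ _).2 ha) b ((hmem _ _).2 hb) hab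
    · exact absurd ha (D1 _ a rfl hab.symm).1
    · exact absurd hb (D1 _ b rfl hab).1
    · rfl
  have nB₂ : NoLoop B₂ := by
    intro a ha b hb hab
    rw [mB₂] at ha hb
    rcases ha with ⟨ha, -⟩ | rfl <;> rcases hb with ⟨hb, -⟩ | rfl
    · exact nW₂ a ((hmem _ _).2 ha) b ((hmem _ _).2 hb) hab
    · exact absurd ha (D1 _ a hyP.symm hab.symm).2
    · exact absurd hb (D1 _ b hyP.symm hab).2
    · rfl
  have hAl : HasLoop A := ⟨x₁, (mA _).2 (by simp), x₂, (mA _).2 (by simp), hx, hxc⟩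
  have multA : ∀ i, i ≠ x₁.1 → mult A i ≤ 1 := by
    intro i hi
    unfold mult
    rw [Finset.card_le_one]
    intro a ha b hb
    simp only [Finset.mem_filter, mA] at ha hb
    obtain ⟨ha, rfl⟩ := ha
    obtain ⟨hb, hb'⟩ := hb
    have ha2 : P a = P y₁ := by
      rcases ha with h | rfl | rfl
      · exact h.1
      · exact absurd rfl hi
      · exact absurd hxc.symm hi
    have hb2 : P b = P y₁ := by
      rcases hb with h | rfl | rfl
      · exact h.1
      · exact absurd hb'.symm hi
      · exact absurd (hb'.symm.trans hxc.symm) hi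
    exact nU a ((hmem _ _).2 ha2) b ((hmem _ _).2 hb2) hb'.symm
  have multA2 : mult A x₁.1 ≤ 2 := by
    unfold mult
    refine (Finset.card_le_card (t := {x₁, x₂}) ?_).trans Finset.card_le_two
    intro p hp
    simp only [Finset.mem_filter, mA] at hp
    simp only [Finset.mem_insert, Finset.mem_singleton]
    rcases hp with ⟨h | h, h2⟩
    · exact absurd rfl (D1 p x₁ h.1 h2).1
    · exact h
  have cardA : A.card = r := by
    rw [hA, Finset.card_union_of_disjoint, Finset.card_sdiff_of_subset, Finset.card_pair hy,
      Finset.card_pair hx, hcard _ (hP _)]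
    · have : ({y₁, y₂} : Finset (Pts k)).card ≤ (P y₁).card := by
        apply Finset.card_le_card
        intro p hp
        simp only [Finset.mem_insert, Finset.mem_singleton] at hp
        rw [hmem]
        rcases hp with rfl | rfl
        · rfl
        · exact hyP.symm
      rw [Finset.card_pair hy, hcard _ (hP _)] at this
      omega
    · intro p hp
      simp only [Finset.mem_insert, Finset.mem_singleton] at hp
      rw [hmem]
      rcases hp with rfl | rfl
      · rfl
      · exact hyP.symm
    · rw [Finset.disjoint_left]
      intro p hp hp'
      simp only [Finset.mem_insert, Finset.mem_singleton, Finset.mem_sdiff, hmem] at hp hp'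
      grind
  have cardB : ∀ x y, P y ≠ P x → ((P x \ {x}) ∪ {y}).card = r := by
    intro x y hxy
    have hx' : x ∈ P x := (hmem _ _).2 rfl
    have h1 : 0 < (P x).card := Finset.card_pos.2 ⟨x, hx'⟩
    rw [Finset.card_union_of_disjoint, Finset.card_sdiff_of_subset, Finset.card_singleton,
      Finset.card_singleton]
    · have := hcard _ (hP x)
      omega
    · simpa using hx'
    · simp [hmem, hxy]
  have cardB₁ : B₁.card = r := by rw [hB₁]; exact cardB _ _ hUW₁
  have cardB₂ : B₂.card = r := by rw [hB₂]; exact cardB _ _ (hyP ▸ hUW₂)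
  have mR : ∀ V, V ∈ (Q \ {P y₁, P x₁, P x₂}) ∪ {A, B₁, B₂} ↔
      (V ∈ Q ∧ V ≠ P y₁ ∧ V ≠ P x₁ ∧ V ≠ P x₂) ∨ V = A ∨ V = B₁ ∨ V = B₂ := by
    intro V; simp; tauto
  have hANQ : A ∉ Q := by
    intro h
    have h1 : P x₁ = A := (hPm A h x₁).1 ((mA _).2 (by simp))
    have h2 : P x₂ = A := (hPm A h x₂).1 ((mA _).2 (by simp))
    exact hWW (h1.trans h2.symm)
  have hloops : nloops ((Q \ {P y₁, P x₁, P x₂}) ∪ {A, B₁, B₂}) = ℓ := by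
    have : ((Q \ {P y₁, P x₁, P x₂}) ∪ {A, B₁, B₂}).filter (fun U => HasLoop U) =
        insert A (Q.filter (fun U => HasLoop U)) := by
      ext V
      rw [Finset.mem_filter, mR, Finset.mem_insert, Finset.mem_filter]
      have h1 := (not_hasLoop_iff _).2 nU
      have h2 := (not_hasLoop_iff _).2 nW₁
      have h3 := (not_hasLoop_iff _).2 nW₂
      have h4 := (not_hasLoop_iff _).2 nB₁
      have h5 := (not_hasLoop_iff _).2 nB₂
      constructor
      · rintro ⟨h | rfl | rfl | rfl, hl⟩
        · exact Or.inr ⟨h.1, hl⟩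
        · exact Or.inl rfl
        · exact absurd hl h4
        · exact absurd hl h5
      · rintro (rfl | ⟨h, hl⟩)
        · exact ⟨Or.inr (Or.inl rfl), hAl⟩
        · refine ⟨Or.inl ⟨h, ?_, ?_, ?_⟩, hl⟩
          · rintro rfl; exact h1 hl
          · rintro rfl; exact h2 hl
          · rintro rfl; exact h3 hl
    unfold nloops at hnl' ⊢
    rw [this, Finset.card_insert_of_notMem (by simp [hANQ]), hnl']
    omega
  -- intersections
  have iA : ∀ V ∈ Q, V ≠ P y₁ → (vset A ∩ vset V).card ≤ 2 := by
    intro V hV hne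
    by_cases hv : x₁.1 ∈ vset V
    · refine (Finset.card_le_card (t := {x₁.1}) ?_).trans (by simp)
      intro i hi
      rw [Finset.mem_inter, mem_vset, mem_vset] at hi
      obtain ⟨⟨p, hp, rfl⟩, q, hq, hpq⟩ := hi
      rw [mA] at hp
      rw [Finset.mem_singleton]
      rcases hp with hp | rfl | rfl
      · obtain ⟨c, hc, hcx⟩ := mem_vset.1 hv
        have := (H p q c x₁ hp.1 hpq.symm
          (((hPm V hV q).1 hq).trans ((hPm V hV c).1 hc).symm) hcx).1
        exact absurd rfl this
      · rfl
      · exact hxc.symm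
    · refine (Finset.card_le_card ?_).trans (hint _ (hP y₁) V hV hne.symm)
      intro i hi
      rw [Finset.mem_inter] at hi ⊢
      refine ⟨?_, hi.2⟩
      obtain ⟨p, hp, rfl⟩ := mem_vset.1 hi.1
      rw [mA] at hp
      rcases hp with hp | rfl | rfl
      · exact mem_vset.2 ⟨p, (hmem _ _).2 hp.1, rfl⟩
      · exact absurd hi.2 hv
      · exact absurd (hxc ▸ hi.2) hv
  have iB : ∀ x y B, P y = P y₁ → (x = x₁ ∨ x = x₂) →
      (∀ p, p ∈ B ↔ (P p = P x ∧ p ≠ x) ∨ p = y) →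
      ∀ V ∈ Q, V ≠ P x → (vset B ∩ vset V).card ≤ 2 := by
    intro x y B hyy hxx mB V hV hne
    by_cases hv : y.1 ∈ vset V
    · refine (Finset.card_le_card (t := {y.1}) ?_).trans (by simp)
      intro i hi
      rw [Finset.mem_inter, mem_vset, mem_vset] at hi
      obtain ⟨⟨p, hp, rfl⟩, q, hq, hpq⟩ := hi
      rw [mB] at hp
      rw [Finset.mem_singleton]
      rcases hp with hp | rfl
      · obtain ⟨c, hc, hcx⟩ := mem_vset.1 hv
        have := H y c q p hyy hcx.symm
          (((hPm V hV c).1 hc).trans ((hPm V hV q).1 hq).symm) hpq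
        rcases hxx with rfl | rfl
        · exact absurd hp.1 this.1
        · exact absurd hp.1 this.2
      · rfl
    · refine (Finset.card_le_card ?_).trans (hint _ (hP x) V hV hne.symm)
      intro i hi
      rw [Finset.mem_inter] at hi ⊢
      refine ⟨?_, hi.2⟩
      obtain ⟨p, hp, rfl⟩ := mem_vset.1 hi.1
      rw [mB] at hp
      rcases hp with hp | rfl
      · exact mem_vset.2 ⟨p, (hmem _ _).2 hp.1, rfl⟩
      · exact absurd hi.2 hv
  have iB₁ := iB x₁ y₁ B₁ rfl (Or.inl rfl) mB₁
  have iB₂ := iB x₂ y₂ B₂ hyP.symm (Or.inr rfl) mB₂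
  have iAB₁ : (vset A ∩ vset B₁).card ≤ 2 := by
    refine (Finset.card_le_card (t := {y₁.1}) ?_).trans (by simp)
    intro i hi
    rw [Finset.mem_inter, mem_vset, mem_vset] at hi
    obtain ⟨⟨p, hp, rfl⟩, q, hq, hpq⟩ := hi
    rw [mA] at hp
    rw [mB₁] at hq
    rw [Finset.mem_singleton]
    rcases hq with hq | rfl
    · rcases hp with hp | rfl | rfl
      · exact absurd hq.1 (D1 p q hp.1 hpq.symm).1
      · exact absurd (nW₁ q ((hmem _ _).2 hq.1) p ((hmem _ _).2 rfl) hpq) hq.2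
      · exact absurd (nW₁ q ((hmem _ _).2 hq.1) x₁ ((hmem _ _).2 rfl) (hpq.trans hxc.symm)) hq.2
    · exact hpq.symm
  have iAB₂ : (vset A ∩ vset B₂).card ≤ 2 := by
    refine (Finset.card_le_card (t := {y₂.1}) ?_).trans (by simp)
    intro i hi
    rw [Finset.mem_inter, mem_vset, mem_vset] at hi
    obtain ⟨⟨p, hp, rfl⟩, q, hq, hpq⟩ := hi
    rw [mA] at hp
    rw [mB₂] at hq
    rw [Finset.mem_singleton]
    rcases hq with hq | rfl
    · rcases hp with hp | rfl | rfl
      · exact absurd hq.1 (D1 p q hp.1 hpq.symm).2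
      · exact absurd (nW₂ q ((hmem _ _).2 hq.1) x₂ ((hmem _ _).2 rfl) (hpq.trans hxc)) hq.2
      · exact absurd (nW₂ q ((hmem _ _).2 hq.1) p ((hmem _ _).2 rfl) hpq) hq.2
    · exact hpq.symm
  have iBB : (vset B₁ ∩ vset B₂).card ≤ 2 := by
    refine (Finset.card_le_card ?_).trans (hint _ (hP x₁) _ (hP x₂) hWW)
    intro i hi
    rw [Finset.mem_inter, mem_vset, mem_vset] at hi ⊢
    obtain ⟨⟨p, hp, rfl⟩, q, hq, hpq⟩ := hi
    rw [mB₁] at hp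
    rw [mB₂] at hq
    rcases hp with hp | rfl
    · rcases hq with hq | rfl
      · exact ⟨⟨p, (hmem _ _).2 hp.1, rfl⟩, q, (hmem _ _).2 hq.1, hpq⟩
      · exact absurd hp.1 (D1 q p hyP.symm hpq).1
    · rcases hq with hq | rfl
      · exact absurd hq.1 (D1 p q rfl hpq.symm).2
      · exact absurd hpq.symm hyc
  refine ⟨⟨⟨?_, ?_⟩, ?_, ?_, ?_, hloops.le.trans hℓ⟩, hloops⟩
  · intro V hV
    rcases (mR V).1 hV with h | rfl | rfl | rfl
    · exact hcard V h.1
    · exact cardA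
    · exact cardB₁
    · exact cardB₂
  · intro p
    have uniq : ∀ V V', V ∈ (Q \ {P y₁, P x₁, P x₂}) ∪ {A, B₁, B₂} →
        V' ∈ (Q \ {P y₁, P x₁, P x₂}) ∪ {A, B₁, B₂} → p ∈ V → p ∈ V' → V = V' := by
      intro V V' hV hV' hp hp'
      have hV := (mR V).1 hV
      have hV' := (mR V').1 hV'
      have e1 : V ∈ Q → P p = V := fun h => (hPm V h p).1 hp
      have e2 : V' ∈ Q → P p = V' := fun h => (hPm V' h p).1 hp'
      have mA := mA p
      have mB₁ := mB₁ p
      have mB₂ := mB₂ p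
      clear H D1 hint hmu hm2 hex hcard iB iB₁ iB₂ iA iAB₁ iAB₂ iBB mR hloops hmem hPm hP
        multA multA2 hA hB₁ hB₂ cardB nB₁ nB₂ nU nW₁ nW₂ hAl hxc hyc cardA cardB₁ cardB₂ hnl hnl'
      rcases hV with h | h | h | h <;> rcases hV' with h' | h' | h' | h' <;>
      first
      | exact h.trans h'.symm
      | exact (e1 h.1).symm.trans (e2 h'.1)
      | (exfalso; subst h; have := mA; have := mB₁; have := mB₂; clear hANQ; grind only)
      | (exfalso; subst h'; have := mA; have := mB₁; have := mB₂; clear hANQ; grind only)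
    obtain ⟨V, hV, hpV⟩ : ∃ V, V ∈ (Q \ {P y₁, P x₁, P x₂}) ∪ {A, B₁, B₂} ∧ p ∈ V := by
      by_cases h1 : p ∈ A
      · exact ⟨A, (mR _).2 (by simp), h1⟩
      by_cases h2 : p ∈ B₁
      · exact ⟨B₁, (mR _).2 (by simp), h2⟩
      by_cases h3 : p ∈ B₂
      · exact ⟨B₂, (mR _).2 (by simp), h3⟩
      refine ⟨P p, (mR _).2 (Or.inl ⟨hP p, ?_⟩), (hmem _ _).2 rfl⟩
      have mA := mA p
      have mB₁ := mB₁ p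
      have mB₂ := mB₂ p
      clear H D1 hint hmu hm2 hex hcard iB iB₁ iB₂ iA iAB₁ iAB₂ iBB mR hloops hmem hPm hP uniq
        multA multA2 hA hB₁ hB₂ cardB nB₁ nB₂ nU nW₁ nW₂ hAl hxc hyc cardA cardB₁ cardB₂ hnl hnl'
      grind only
    exact ⟨V, ⟨hV, hpV⟩, fun V' h => uniq V' V h.1 hV h.2 hpV⟩
  · intro V hV i
    rcases (mR V).1 hV with h | rfl | rfl | rfl
    · exact hm2 V h.1 i
    · by_cases hi : i = x₁.1
      · rw [hi]; exact multA2
      · exact (multA i hi).trans (by norm_num)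
    · exact (mult_le_one nB₁ i).trans (by norm_num)
    · exact (mult_le_one nB₂ i).trans (by norm_num)
  · intro V hV i j hi hj
    rcases (mR V).1 hV with h | rfl | rfl | rfl
    · exact hmu V h.1 i j hi hj
    · have aux : ∀ i, mult V i = 2 → i = x₁.1 := by
        intro i hi
        by_contra hne
        have := multA i hne
        omega
      rw [aux i hi, aux j hj]
    · have := mult_le_one nB₁ i
      omega
    · have := mult_le_one nB₂ i
      omega
  · intro V hV V' hV' hne
    rcases (mR V).1 hV with h | h | h | h <;>
    rcases (mR V').1 hV' with h' | h' | h' | h'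
    · exact hint V h.1 V' h'.1 hne
    · rw [h', Finset.inter_comm]; exact iA V h.1 h.2.1
    · rw [h', Finset.inter_comm]; exact iB₁ V h.1 h.2.2.1
    · rw [h', Finset.inter_comm]; exact iB₂ V h.1 h.2.2.2
    · rw [h]; exact iA V' h'.1 h'.2.1
    · exact absurd (h.trans h'.symm) hne
    · rw [h, h']; exact iAB₁
    · rw [h, h']; exact iAB₂
    · rw [h]; exact iB₁ V' h'.1 h'.2.2.1
    · rw [h, h', Finset.inter_comm]; exact iAB₁
    · exact absurd (h.trans h'.symm) hne
    · rw [h, h']; exact iBB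
    · rw [h]; exact iB₂ V' h'.1 h'.2.2.2
    · rw [h, h', Finset.inter_comm]; exact iAB₂
    · rw [h, h', Finset.inter_comm]; exact iBB
    · exact absurd (h.trans h'.symm) hne

lemma card_pts : Fintype.card (Pts k) = Mtot k := by
  simp [Mtot]

def cell (x : Pts k) : Finset (Pts k) := Finset.univ.filter fun y => y.1 = x.1

lemma card_cell (x : Pts k) : (cell x).card = k x.1 := by
  have : cell x = (Finset.univ : Finset (Fin (k x.1))).map
      ⟨fun j => (⟨x.1, j⟩ : Pts k), fun a b h => by simpa using h⟩ := by
    ext ⟨i, j⟩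
    simp only [cell, Finset.mem_filter, Finset.mem_univ, true_and, Finset.mem_map]
    constructor
    · rintro rfl
      exact ⟨j, rfl⟩
    · rintro ⟨a, ha⟩
      exact (congrArg Sigma.fst ha).symm
  rw [this, Finset.card_map, Finset.card_univ, Fintype.card_fin]

lemma card_cell_le (x : Pts k) : (cell x).card ≤ kmax k := by
  rw [card_cell]
  exact Finset.le_sup (f := k) (Finset.mem_univ x.1)

lemma mem_cell {x y : Pts k} : y ∈ cell x ↔ y.1 = x.1 := by simp [cell]

/-- All pairs-of-pairs considered. -/
noncomputable def Sx (k : Fin n → ℕ) : Finset (Pts k × Pts k) :=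
  Finset.univ.filter fun t => t.1 ≠ t.2 ∧ t.1.1 = t.2.1

noncomputable def Sy (P : Pts k → Finset (Pts k)) : Finset (Pts k × Pts k) :=
  Finset.univ.filter fun t => t.1 ≠ t.2 ∧ P t.1 = P t.2

lemma card_pairs (p : Pts k → Pts k → Prop) [DecidablePred fun t : Pts k × Pts k => p t.1 t.2]
    [∀ x, DecidablePred (p x)] :
    (Finset.univ.filter fun t : Pts k × Pts k => p t.1 t.2).card =
      ∑ x, (Finset.univ.filter fun y => p x y).card := by
  simp only [Finset.card_filter]
  rw [Fintype.sum_prod_type]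

lemma card_Sx : (Sx k).card = M2 k := by
  unfold Sx
  rw [card_pairs (fun x y => x ≠ y ∧ x.1 = y.1)]
  have : ∀ x : Pts k, (Finset.univ.filter fun y => x ≠ y ∧ x.1 = y.1).card = k x.1 - 1 := by
    intro x
    rw [← card_cell x, ← Finset.card_erase_of_mem (mem_cell.2 rfl : x ∈ cell x)]
    congr 1
    ext y
    simp only [Finset.mem_filter, Finset.mem_univ, true_and, Finset.mem_erase, mem_cell]
    tauto
  simp only [this]
  rw [Fintype.sum_sigma]
  simp [M2]

lemma card_Sy {r : ℕ} {P : Pts k → Finset (Pts k)} (hc : ∀ p, (P p).card = r)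
    (hmem : ∀ p q, p ∈ P q ↔ P p = P q) : (Sy P).card = Mtot k * (r - 1) := by
  unfold Sy
  rw [card_pairs (fun x y => x ≠ y ∧ P x = P y)]
  have : ∀ x : Pts k, (Finset.univ.filter fun y => x ≠ y ∧ P x = P y).card = r - 1 := by
    intro x
    rw [← hc x, ← Finset.card_erase_of_mem ((hmem x x).2 rfl)]
    congr 1
    ext y
    simp only [Finset.mem_filter, Finset.mem_univ, true_and, Finset.mem_erase, hmem]
    tauto
  simp only [this]
  simp [Mtot]

/-- Points reachable from `y` by part-cell-part-cell-part steps. -/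
def Reach (P : Pts k → Finset (Pts k)) (y : Pts k) : Finset (Pts k) :=
  (P y).biUnion fun a => (cell a).biUnion fun b => (P b).biUnion fun c =>
    (cell c).biUnion fun d => P d

lemma card_Reach {r : ℕ} {P : Pts k → Finset (Pts k)} (hc : ∀ p, (P p).card = r) (y : Pts k) :
    (Reach P y).card ≤ r * (kmax k * (r * (kmax k * r))) := by
  have key : ∀ (s : Finset (Pts k)) (f : Pts k → Finset (Pts k)) (m D : ℕ), s.card ≤ m →
      (∀ a, (f a).card ≤ D) → (s.biUnion f).card ≤ m * D := fun s f m D hs hf =>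
    (Finset.card_biUnion_le_card_mul s f D fun a _ => hf a).trans (Nat.mul_le_mul_right _ hs)
  unfold Reach
  refine key _ _ _ _ (hc _).le fun a => key _ _ _ _ (card_cell_le _) fun b =>
    key _ _ _ _ (hc _).le fun c => key _ _ _ _ (card_cell_le _) fun d => (hc d).le

/-- generic bound for a set of tuples given by a chain of choices -/
lemma card_chain {α : Type*} [DecidableEq α] (T : Finset α)
    (s₁ : Finset (Pts k)) (s₂ s₃ s₄ : Pts k → Finset (Pts k)) (g : Pts k → Pts k → Pts k → Pts k → α)
    (d₁ d₂ d₃ d₄ : ℕ) (h₁ : s₁.card ≤ d₁) (h₂ : ∀ a, (s₂ a).card ≤ d₂)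
    (h₃ : ∀ a, (s₃ a).card ≤ d₃) (h₄ : ∀ a, (s₄ a).card ≤ d₄)
    (hT : ∀ t ∈ T, ∃ a ∈ s₁, ∃ b ∈ s₂ a, ∃ c ∈ s₃ a, ∃ d ∈ s₄ c, g a b c d = t) :
    T.card ≤ d₁ * (d₂ * (d₃ * d₄)) := by
  have key : ∀ (s : Finset (Pts k)) (f : Pts k → Finset α) (m D : ℕ), s.card ≤ m →
      (∀ a, (f a).card ≤ D) → (s.biUnion f).card ≤ m * D := fun s f m D hs hf =>
    (Finset.card_biUnion_le_card_mul s f D fun a _ => hf a).trans (Nat.mul_le_mul_right _ hs)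
  have hsub : T ⊆ s₁.biUnion fun a => (s₂ a).biUnion fun b => (s₃ a).biUnion fun c =>
      (s₄ c).image fun d => g a b c d := by
    intro t ht
    simpa only [Finset.mem_biUnion, Finset.mem_image] using hT t ht
  refine (Finset.card_le_card hsub).trans ?_
  exact key _ _ _ _ h₁ fun a => key _ _ _ _ (h₂ a) fun b =>
    key _ _ _ _ (h₃ a) fun c => Finset.card_image_le.trans (h₄ c)

lemma count_bounds {r ℓ : ℕ} {Q : Finset (Finset (Pts k))} (hℓ1 : 1 ≤ ℓ)
    (hℓ : ℓ ≤ Nbound r k) (hQ : Q ∈ Cset r k (ℓ - 1)) :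
    ∃ b : ℕ, (legalReverseTuples r k ℓ Q).ncard + b = M2 k * (Mtot k * (r - 1)) ∧
      b ≤ 3 * (Mtot k * r * (ℓ * r) * kmax k) + 2 * (Mtot k * r * (r ^ 3 * kmax k ^ 3)) := by
  obtain ⟨P, hP, hPm⟩ := exists_part hQ.1.1
  have hmem : ∀ p q, p ∈ P q ↔ P p = P q := fun p q => hPm _ (hP q) p
  have hc : ∀ p, (P p).card = r := fun p => hQ.1.1.1 _ (hP p)
  obtain ⟨S, hS⟩ : ∃ S : Finset (Pts k × Pts k × Pts k × Pts k), S =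
    (Sx k ×ˢ Sy P).image (fun t => (t.1.1, t.1.2, t.2.1, t.2.2)) := ⟨_, rfl⟩
  have cS : S.card = M2 k * (Mtot k * (r - 1)) := by
    rw [hS, Finset.card_image_of_injective, Finset.card_product, card_Sx, card_Sy hc hmem]
    rintro ⟨⟨a, b⟩, c, d⟩ ⟨⟨a', b'⟩, c', d'⟩ h
    simpa [and_assoc] using h
  have mS : ∀ x₁ x₂ y₁ y₂, (x₁, x₂, y₁, y₂) ∈ S ↔
      (x₁ ≠ x₂ ∧ x₁.1 = x₂.1) ∧ (y₁ ≠ y₂ ∧ P y₁ = P y₂) := by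
    intro x₁ x₂ y₁ y₂
    simp only [hS, Sx, Sy, Finset.mem_image, Finset.mem_product, Finset.mem_filter,
      Finset.mem_univ, true_and]
    constructor
    · rintro ⟨⟨⟨a, b⟩, c, d⟩, h, heq⟩
      simp only [Prod.mk.injEq] at heq
      obtain ⟨rfl, rfl, rfl, rfl⟩ := heq
      exact h
    · intro h
      exact ⟨((x₁, x₂), (y₁, y₂)), h, rfl⟩
  obtain ⟨F, hF⟩ : ∃ F, F = S.filter (fun t => t ∈ legalReverseTuples r k ℓ Q) := ⟨_, rfl⟩
  have hFset : legalReverseTuples r k ℓ Q = (F : Set (Pts k × Pts k × Pts k × Pts k)) := by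
    ext ⟨x₁, x₂, y₁, y₂⟩
    rw [hF, Finset.coe_filter, Set.mem_ofPred_eq, mS]
    constructor
    · intro h
      refine ⟨?_, h⟩
      obtain ⟨U, W₁, W₂, ⟨hU, hW₁, hW₂, -, -, hWW, hx₁, hx₂, hxc, hy₁, hy₂, hy, -⟩, -⟩ := h
      refine ⟨⟨?_, hxc⟩, hy, ((hPm U hU _).1 hy₁).trans ((hPm U hU _).1 hy₂).symm⟩
      rintro rfl
      exact hWW (((hPm _ hW₁ _).1 hx₁).symm.trans ((hPm _ hW₂ _).1 hx₂))
    · exact fun h => h.2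
  refine ⟨(S.filter (fun t => t ∉ legalReverseTuples r k ℓ Q)).card, ?_, ?_⟩
  · rw [← cS, hFset, Set.ncard_coe_finset, ← hFset, hF]
    exact Finset.card_filter_add_card_filter_not _
  obtain ⟨L, hL⟩ : ∃ L, L = (Q.filter fun U => HasLoop U).biUnion id := ⟨_, rfl⟩
  have cL : L.card ≤ ℓ * r := by
    rw [hL]
    refine (Finset.card_biUnion_le_card_mul _ _ r ?_).trans (Nat.mul_le_mul_right _ ?_)
    · intro U hU
      exact (hQ.1.1.1 U (Finset.mem_filter.1 hU).1).le
    · have := hQ.2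
      unfold nloops at this
      omega
  have nL : ∀ p, p ∉ L → NoLoop (P p) := by
    intro p hp
    rw [← not_hasLoop_iff]
    intro h
    apply hp
    rw [hL, Finset.mem_biUnion]
    exact ⟨P p, Finset.mem_filter.2 ⟨hP p, h⟩, (hmem _ _).2 rfl⟩
  have hsub : S.filter (fun t => t ∉ legalReverseTuples r k ℓ Q) ⊆
      (S.filter (fun t => t.2.2.1 ∈ L) ∪ S.filter (fun t => t.1 ∈ L) ∪
        S.filter (fun t => t.2.1 ∈ L)) ∪
      (S.filter (fun t => t.1 ∈ Reach P t.2.2.1) ∪ S.filter (fun t => t.2.1 ∈ Reach P t.2.2.1)) := by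
    rintro ⟨x₁, x₂, y₁, y₂⟩ ht
    rw [Finset.mem_filter] at ht
    obtain ⟨htS, ht⟩ := ht
    by_contra hcon
    simp only [Finset.mem_union, Finset.mem_filter, htS, true_and, not_or] at hcon
    obtain ⟨⟨⟨h1, h2⟩, h3⟩, h4, h5⟩ := hcon
    obtain ⟨⟨hx, hxc⟩, hy, hyP⟩ := (mS _ _ _ _).1 htS
    refine ht (legal_of_good hℓ1 hℓ hQ P hP hPm x₁ x₂ y₁ y₂ hx hxc hy hyP (nL _ h1) (nL _ h2)
      (nL _ h3) ?_)
    intro a b c d e1 e2 e3 e4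
    simp only [Reach, Finset.mem_biUnion, mem_cell, hmem] at h4 h5
    exact ⟨fun h => h4 ⟨a, e1, b, e2.symm, c, e3.symm, d, e4.symm, h.symm⟩,
      fun h => h5 ⟨a, e1, b, e2.symm, c, e3.symm, d, e4.symm, h.symm⟩⟩
  have cU : (Finset.univ : Finset (Pts k)).card ≤ Mtot k := by
    rw [Finset.card_univ, card_pts]
  have b1 : (S.filter (fun t => t.2.2.1 ∈ L)).card ≤ ℓ * r * (r * (Mtot k * kmax k)) := by
    refine card_chain _ L P (fun _ => Finset.univ) cell (fun y₁ y₂ x₁ x₂ => (x₁, x₂, y₁, y₂))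
      _ _ _ _ cL (fun a => (hc a).le) (fun _ => cU) card_cell_le ?_
    rintro ⟨x₁, x₂, y₁, y₂⟩ ht
    rw [Finset.mem_filter, mS] at ht
    exact ⟨y₁, ht.2, y₂, (hmem _ _).2 ht.1.2.2.symm, x₁, Finset.mem_univ _, x₂,
      mem_cell.2 ht.1.1.2.symm, rfl⟩
  have b2 : (S.filter (fun t => t.1 ∈ L)).card ≤ ℓ * r * (kmax k * (Mtot k * r)) := by
    refine card_chain _ L cell (fun _ => Finset.univ) P (fun x₁ x₂ y₁ y₂ => (x₁, x₂, y₁, y₂))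
      _ _ _ _ cL card_cell_le (fun _ => cU) (fun a => (hc a).le) ?_
    rintro ⟨x₁, x₂, y₁, y₂⟩ ht
    rw [Finset.mem_filter, mS] at ht
    exact ⟨x₁, ht.2, x₂, mem_cell.2 ht.1.1.2.symm, y₁, Finset.mem_univ _, y₂,
      (hmem _ _).2 ht.1.2.2.symm, rfl⟩
  have b3 : (S.filter (fun t => t.2.1 ∈ L)).card ≤ ℓ * r * (kmax k * (Mtot k * r)) := by
    refine card_chain _ L cell (fun _ => Finset.univ) P (fun x₂ x₁ y₁ y₂ => (x₁, x₂, y₁, y₂))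
      _ _ _ _ cL card_cell_le (fun _ => cU) (fun a => (hc a).le) ?_
    rintro ⟨x₁, x₂, y₁, y₂⟩ ht
    rw [Finset.mem_filter, mS] at ht
    exact ⟨x₂, ht.2, x₁, mem_cell.2 ht.1.1.2, y₁, Finset.mem_univ _, y₂,
      (hmem _ _).2 ht.1.2.2.symm, rfl⟩
  have b4 : (S.filter (fun t => t.1 ∈ Reach P t.2.2.1)).card ≤
      Mtot k * (r * (r * (kmax k * (r * (kmax k * r))) * kmax k)) := by
    refine card_chain _ Finset.univ P (Reach P) cell (fun y₁ y₂ x₁ x₂ => (x₁, x₂, y₁, y₂))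
      _ _ _ _ cU (fun a => (hc a).le) (card_Reach hc) card_cell_le ?_
    rintro ⟨x₁, x₂, y₁, y₂⟩ ht
    rw [Finset.mem_filter, mS] at ht
    exact ⟨y₁, Finset.mem_univ _, y₂, (hmem _ _).2 ht.1.2.2.symm, x₁, ht.2, x₂,
      mem_cell.2 ht.1.1.2.symm, rfl⟩
  have b5 : (S.filter (fun t => t.2.1 ∈ Reach P t.2.2.1)).card ≤
      Mtot k * (r * (r * (kmax k * (r * (kmax k * r))) * kmax k)) := by
    refine card_chain _ Finset.univ P (Reach P) cell (fun y₁ y₂ x₂ x₁ => (x₁, x₂, y₁, y₂))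
      _ _ _ _ cU (fun a => (hc a).le) (card_Reach hc) card_cell_le ?_
    rintro ⟨x₁, x₂, y₁, y₂⟩ ht
    rw [Finset.mem_filter, mS] at ht
    exact ⟨y₁, Finset.mem_univ _, y₂, (hmem _ _).2 ht.1.2.2.symm, x₂, ht.2, x₁,
      mem_cell.2 ht.1.1.2, rfl⟩
  refine (Finset.card_le_card hsub).trans ?_
  refine (Finset.card_union_le _ _).trans ?_
  refine (add_le_add ((Finset.card_union_le _ _).trans (add_le_add_left (Finset.card_union_le _ _) _))
    (Finset.card_union_le _ _)).trans ?_
  refine (add_le_add (add_le_add (add_le_add b1 b2) b3) (add_le_add b4 b5)).trans (le_of_eq ?_)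
  ring

end helpers

/-- the number of legal reverse ℓ-switchings from `Q' ∈ C_{ℓ-1}`
is `(r−1)·M·M₂·(1 + O((k_max³ + ℓ·k_max)/M₂))` (equation (6) of the paper). -/
theorem legal_reverse_switching_count (r : ℕ) (hr : 3 ≤ r) :
    ∃ C δ : ℝ, 0 < C ∧ 0 < δ ∧
      ∀ (n : ℕ) (k : Fin n → ℕ) (ℓ : ℕ) (Q' : Finset (Finset (Pts k))),
        r ∣ Mtot k → 2 ≤ kmax k → (kmax k : ℝ) ^ 3 ≤ δ * (Mtot k : ℝ) →
        1 ≤ ℓ → ℓ ≤ Nbound r k → Q' ∈ Cset r k (ℓ - 1) →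
        ∃ E : ℝ, |E| ≤ C * ((kmax k : ℝ) ^ 3 + (ℓ : ℝ) * (kmax k : ℝ)) / (M2 k : ℝ) ∧
          (Set.ncard (legalReverseTuples r k ℓ Q') : ℝ) =
            ((r : ℝ) - 1) * (Mtot k : ℝ) * (M2 k : ℝ) * (1 + E) := by
  refine ⟨3 * (r : ℝ) ^ 4, 1, by positivity, one_pos, ?_⟩
  intro n k ℓ Q' _ hk _ hℓ1 hℓ hQ
  obtain ⟨b, hb, hb'⟩ := count_bounds hℓ1 hℓ hQ
  have hM2 : 0 < M2 k := by
    obtain ⟨i, hi⟩ : ∃ i, 2 ≤ k i := by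
      by_contra hcon
      push Not at hcon
      have : kmax k ≤ 1 := Finset.sup_le fun i _ => Nat.lt_succ_iff.1 (hcon i)
      omega
    have h1 : k i * (k i - 1) ≤ M2 k :=
      Finset.single_le_sum (f := fun i => k i * (k i - 1)) (fun _ _ => Nat.zero_le _)
        (Finset.mem_univ i)
    have h2 : 0 < k i * (k i - 1) := Nat.mul_pos (by omega) (by omega)
    omega
  have hM : 0 < Mtot k := by
    by_contra h0
    have h0 : ∑ i, k i = 0 := by simpa [Mtot] using h0
    rw [Finset.sum_eq_zero_iff] at h0
    have : M2 k = 0 := Finset.sum_eq_zero fun i hi => by simp [h0 i hi]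
    omega
  have hbR : (b : ℝ) ≤ 3 * ((Mtot k : ℝ) * r * (ℓ * r) * kmax k) +
      2 * ((Mtot k : ℝ) * r * ((r : ℝ) ^ 3 * (kmax k : ℝ) ^ 3)) := by exact_mod_cast hb'
  have hbE : ((legalReverseTuples r k ℓ Q').ncard : ℝ) + b =
      (M2 k : ℝ) * (Mtot k * ((r : ℝ) - 1)) := by
    have : ((r - 1 : ℕ) : ℝ) = (r : ℝ) - 1 := by
      rw [Nat.cast_sub (by omega)]; simp
    rw [← this]
    exact_mod_cast hb
  have hM2R : (0 : ℝ) < M2 k := by exact_mod_cast hM2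
  have hMR : (0 : ℝ) < Mtot k := by exact_mod_cast hM
  have hrR : (3 : ℝ) ≤ r := by exact_mod_cast hr
  have hr1 : (0 : ℝ) < (r : ℝ) - 1 := by linarith
  have hT : (0 : ℝ) < ((r : ℝ) - 1) * (Mtot k : ℝ) * (M2 k : ℝ) := by positivity
  refine ⟨-((b : ℝ) / (((r : ℝ) - 1) * (Mtot k : ℝ) * (M2 k : ℝ))), ?_, ?_⟩
  · rw [abs_neg, abs_of_nonneg (by positivity), div_le_div_iff₀ hT hM2R]
    have h1 : (b : ℝ) ≤ 3 * (r : ℝ) ^ 4 * ((kmax k : ℝ) ^ 3 + (ℓ : ℝ) * (kmax k : ℝ)) * Mtot k := by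
      have hrr : (r : ℝ) ^ 2 ≤ (r : ℝ) ^ 4 := pow_le_pow_right₀ (by linarith) (by norm_num)
      have h2 : (r : ℝ) ^ 2 * ((Mtot k : ℝ) * ℓ * kmax k) ≤
          (r : ℝ) ^ 4 * ((Mtot k : ℝ) * ℓ * kmax k) :=
        mul_le_mul_of_nonneg_right hrr (by positivity)
      have h3 : 0 ≤ (r : ℝ) ^ 4 * ((Mtot k : ℝ) * (kmax k : ℝ) ^ 3) := by positivity
      linarith
    have h4 : 3 * (r : ℝ) ^ 4 * ((kmax k : ℝ) ^ 3 + (ℓ : ℝ) * (kmax k : ℝ)) * Mtot k * 1 ≤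
        3 * (r : ℝ) ^ 4 * ((kmax k : ℝ) ^ 3 + (ℓ : ℝ) * (kmax k : ℝ)) * Mtot k * ((r : ℝ) - 1) :=
      mul_le_mul_of_nonneg_left (by linarith) (by positivity)
    calc (b : ℝ) * M2 k ≤ (3 * (r : ℝ) ^ 4 * ((kmax k : ℝ) ^ 3 + (ℓ : ℝ) * (kmax k : ℝ)) *
          Mtot k * ((r : ℝ) - 1)) * M2 k :=
          mul_le_mul_of_nonneg_right (by linarith) hM2R.le
      _ = _ := by ring
  · rw [mul_add, mul_neg, mul_div_cancel₀ _ hT.ne']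
    linarith
end
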